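/- arXiv:1003.0156 — 4 statements merged into one kernel-verified Lean document; each statement's English description precedes it below -/
import Mathlib

section
/- Let s and t be coprime natural numbers, both greater than 1, and let n be a natural number. If X and Y are invertible n×n matrices over ℤ/(st)ℤ, then the matrix sX + tY is also an invertible n×n matrix over ℤ/(st)ℤ. -/
/-- In an algebra over a commutative ring, if `r` and `r'` are coprime scalars with `r * r' = 0`,
then `r • x + r' • y` is a unit whenever `x` and `y` are. -/
theorem IsUnit.smul_add_smul_of_isCoprime {R A : Type*} [CommRing R] [Ring A] [Algebra R A]
    {r r' : R} (hcop : IsCoprime r r') (hmul : r * r' = 0) {x y : A}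
    (hx : IsUnit x) (hy : IsUnit y) : IsUnit (r • x + r' • y) := by
  obtain ⟨a, b, hab⟩ := hcop
  obtain ⟨u, rfl⟩ := hx
  obtain ⟨v, rfl⟩ := hy
  have hone : r * (a ^ 2 * r) + r' * (b ^ 2 * r') = 1 := by
    linear_combination (a * r + b * r' + 1) * hab - 2 * a * b * hmul
  have hleft : r * (b ^ 2 * r') = 0 := by linear_combination b ^ 2 * hmul
  have hright : r' * (a ^ 2 * r) = 0 := by linear_combination a ^ 2 * hmul
  refine ⟨⟨r • (u : A) + r' • (v : A),
    (a ^ 2 * r) • (↑u⁻¹ : A) + (b ^ 2 * r') • (↑v⁻¹ : A), ?_, ?_⟩, rfl⟩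
  · simp only [add_mul, mul_add, smul_mul_smul_comm, Units.mul_inv, hleft, hright, zero_smul,
      add_zero, zero_add]
    rw [← add_smul, hone, one_smul]
  · simp only [add_mul, mul_add, smul_mul_smul_comm, Units.inv_mul, mul_comm (a ^ 2 * r),
      mul_comm (b ^ 2 * r'), hleft, hright, zero_smul, add_zero, zero_add]
    rw [← add_smul, hone, one_smul]

/-- If `s, t > 1` are coprime naturals and `X, Y` are invertible `n×n` matrices over
`ℤ/(st)ℤ`, then `s • X + t • Y` is invertible. -/
theorem isUnit_smul_add_smul_of_isUnit
    (s t n : ℕ) (hs : 1 < s) (ht : 1 < t) (hst : Nat.Coprime s t)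
    (X Y : Matrix (Fin n) (Fin n) (ZMod (s * t)))
    (hX : IsUnit X) (hY : IsUnit Y) :
    IsUnit ((s : ZMod (s * t)) • X + (t : ZMod (s * t)) • Y) := by
  have hcop : IsCoprime (s : ZMod (s * t)) (t : ZMod (s * t)) := by
    simpa using (Nat.isCoprime_iff_coprime.mpr hst).map (Int.castRingHom (ZMod (s * t)))
  have hmul : (s : ZMod (s * t)) * (t : ZMod (s * t)) = 0 := by
    rw [← Nat.cast_mul, ZMod.natCast_self]
  exact IsUnit.smul_add_smul_of_isCoprime hcop hmul hX hY
end

section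
/- Let p be a prime, t ≥ 2 a natural number, and n ≥ 2. For any n×n matrix X over ℤ/p^tℤ there exists an n×n matrix Y over ℤ/p^tℤ such that p^{t-1}·Y + I commutes with X, is invertible, and is not a scalar matrix. -/
theorem natCast_prime_pow_pred_mul_self (p t : ℕ) (ht : 2 ≤ t) :
    (p : ZMod (p ^ t)) ^ (t - 1) * (p : ZMod (p ^ t)) ^ (t - 1) = 0 := by
  rw [← pow_add, ← Nat.cast_pow, ZMod.natCast_eq_zero_iff]
  exact pow_dvd_pow p (by omega)

theorem natCast_prime_pow_pred_ne_zero (p t : ℕ) (hp : p.Prime) (ht : 1 ≤ t) :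
    (p : ZMod (p ^ t)) ^ (t - 1) ≠ 0 := by
  rw [← Nat.cast_pow, Ne, ZMod.natCast_eq_zero_iff, Nat.pow_dvd_pow_iff_le_right hp.one_lt]
  omega

theorem isUnit_smul_add_one_of_mul_self_eq_zero {R A : Type*} [CommRing R] [Ring A] [Algebra R A]
    {q : R} (hq : q * q = 0) (a : A) : IsUnit (q • a + 1) := by
  refine IsNilpotent.isUnit_add_one ⟨2, ?_⟩
  rw [smul_pow, pow_two q, hq, zero_smul]

/-- Let `p` be a prime, `t ≥ 2` and `n ≥ 2`. For any `n×n` matrix `X` over `ℤ/pᵗℤ`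
there is a matrix `Y` such that `p^(t-1) • Y + I` commutes with `X`, is invertible,
and is not a scalar matrix. -/
theorem exists_nonscalar_unit_commuting_prime_pow
    (p t n : ℕ) (hp : p.Prime) (ht : 2 ≤ t) (hn : 2 ≤ n)
    (X : Matrix (Fin n) (Fin n) (ZMod (p ^ t))) :
    ∃ Y : Matrix (Fin n) (Fin n) (ZMod (p ^ t)),
      ((p : ZMod (p ^ t)) ^ (t - 1) • Y + 1) * X = X * ((p : ZMod (p ^ t)) ^ (t - 1) • Y + 1) ∧
      IsUnit ((p : ZMod (p ^ t)) ^ (t - 1) • Y + 1) ∧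
      ¬ ∃ c : ZMod (p ^ t),
          (p : ZMod (p ^ t)) ^ (t - 1) • Y + 1
            = c • (1 : Matrix (Fin n) (Fin n) (ZMod (p ^ t))) := by
  set q : ZMod (p ^ t) := (p : ZMod (p ^ t)) ^ (t - 1)
  have hqq : q * q = 0 := natCast_prime_pow_pred_mul_self p t ht
  have hq0 : q ≠ 0 := natCast_prime_pow_pred_ne_zero p t hp (by omega)
  by_cases h : ∃ c : ZMod (p ^ t), q • X + 1 = c • (1 : Matrix (Fin n) (Fin n) (ZMod (p ^ t)))
  · obtain ⟨c, hc⟩ := h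
    have hX : q • X = (c - 1) • (1 : Matrix (Fin n) (Fin n) (ZMod (p ^ t))) := by
      rw [sub_smul, one_smul, ← hc, add_sub_cancel_right]
    let i : Fin n := ⟨0, by omega⟩
    let j : Fin n := ⟨1, by omega⟩
    have hij : i ≠ j := by simp [i, j]
    refine ⟨Matrix.single i i 1, ?_, isUnit_smul_add_one_of_mul_self_eq_zero hqq _, ?_⟩
    · rw [add_mul, mul_add, one_mul, mul_one, smul_mul_assoc, mul_smul_comm,
        ← mul_smul_comm, ← smul_mul_assoc, hX]
      simp
    · rintro ⟨d, hd⟩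
      have hi := congrFun (congrFun hd i) i
      have hj := congrFun (congrFun hd j) j
      simp [hij] at hi hj
      rw [← hj] at hi
      exact hq0 (by simpa using hi)
  · refine ⟨X, ?_, isUnit_smul_add_one_of_mul_self_eq_zero hqq _, h⟩
    rw [add_mul, mul_add, one_mul, mul_one, smul_mul_assoc, mul_smul_comm]
end

section
/- Let s and t be coprime natural numbers, both greater than 1, and let n ≥ 2. For any n×n matrix X over ℤ/(st)ℤ there exist an n×n matrix Y over ℤ/(st)ℤ and an element k ∈ ℤ/(st)ℤ such that s·Y + k·I commutes with X and is not a scalar matrix. -/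
/-- Let `s, t > 1` be coprime naturals and `n ≥ 2`. For any `n×n` matrix `X` over
`ℤ/(st)ℤ` there exist a matrix `Y` and a scalar `k` such that `s • Y + k • I` commutes
with `X` and is not a scalar matrix. -/
theorem exists_nonscalar_commuting_coprime_factors
    (s t n : ℕ) (hs : 1 < s) (ht : 1 < t) (hst : Nat.Coprime s t) (hn : 2 ≤ n)
    (X : Matrix (Fin n) (Fin n) (ZMod (s * t))) :
    ∃ (Y : Matrix (Fin n) (Fin n) (ZMod (s * t))) (k : ZMod (s * t)),
      ((s : ZMod (s * t)) • Y + k • 1) * X = X * ((s : ZMod (s * t)) • Y + k • 1) ∧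
      ¬ ∃ c : ZMod (s * t),
          (s : ZMod (s * t)) • Y + k • 1
            = c • (1 : Matrix (Fin n) (Fin n) (ZMod (s * t))) := by
  by_cases h : ∃ c : ZMod (s * t),
      (s : ZMod (s * t)) • X = c • (1 : Matrix (Fin n) (Fin n) (ZMod (s * t)))
  · obtain ⟨c, hc⟩ := h
    let i : Fin n := ⟨0, by omega⟩
    let j : Fin n := ⟨1, by omega⟩
    have hij : i ≠ j := by simp [i, j]
    refine ⟨Matrix.single i i 1, 0, ?_, ?_⟩
    · rw [zero_smul, add_zero, smul_mul_assoc, ← mul_smul_comm, mul_smul_comm (s : ZMod (s * t)) X,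
        ← smul_mul_assoc, hc, mul_smul_comm, smul_mul_assoc, mul_one, one_mul]
    · rintro ⟨d, hd⟩
      have hi := congrFun (congrFun hd i) i
      have hj := congrFun (congrFun hd j) j
      simp [hij] at hi hj
      rw [← hj, ZMod.natCast_eq_zero_iff] at hi
      have := Nat.le_of_dvd (by omega) hi
      nlinarith
  · exact ⟨X, 0, by simp, by simpa using h⟩
end

section
/- Let s and t be coprime natural numbers, both greater than 1, and let n ≥ 2. For any invertible n×n matrix X over ℤ/(st)ℤ there exist an n×n matrix Y over ℤ/(st)ℤ and an element k ∈ ℤ/(st)ℤ such that s·Y + k·I commutes with X, is invertible, and is not a scalar matrix. -/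
open Matrix in
/-- Over a commutative ring, if `e ≠ 0`, then every invertible matrix `X` of size at least two
admits an invertible `W` that commutes with `X` after multiplication by `e` and such that `e • W`
is not scalar. -/
theorem Matrix.exists_isUnit_commute_smul_not_scalar {R m : Type*} [CommRing R] [Fintype m]
    [DecidableEq m] [Nontrivial m] {e : R} (he : e ≠ 0) {X : Matrix m m R} (hX : IsUnit X) :
    ∃ W : Matrix m m R, IsUnit W ∧ Commute (e • W) X ∧
      ¬ ∃ c : R, e • W = c • (1 : Matrix m m R) := by
  by_cases h : ∃ c : R, e • X = c • (1 : Matrix m m R)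
  · obtain ⟨c, hc⟩ := h
    obtain ⟨i, j, hij⟩ := exists_pair_ne m
    refine ⟨transvection i j 1, ?_, ?_, ?_⟩
    · simp [isUnit_iff_isUnit_det, det_transvection_of_ne i j hij]
    · rw [Commute, SemiconjBy, mul_smul_comm, smul_mul_assoc, ← mul_smul_comm, ← smul_mul_assoc,
        hc, mul_smul_comm, smul_mul_assoc, mul_one, one_mul]
    · rintro ⟨d, hd⟩
      have hentry := congrFun (congrFun hd i) j
      simp [transvection, hij] at hentry
      exact he hentry
  · exact ⟨X, hX, (Commute.refl X).smul_left e, h⟩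

/-- For an idempotent `e`, the element `e • W + (1 - e) • 1` is a unit whenever `W` is. -/
theorem IsUnit.smul_add_one_sub_smul_one {R A : Type*} [CommRing R] [Ring A] [Algebra R A]
    {e : R} (he : IsIdempotentElem e) {W : A} (hW : IsUnit W) :
    IsUnit (e • W + (1 - e) • (1 : A)) := by
  obtain ⟨V, hWV, hVW⟩ := isUnit_iff_exists.mp hW
  have key (a b : A) (hab : a * b = 1) :
      (e • a + (1 - e) • (1 : A)) * (e • b + (1 - e) • (1 : A)) = 1 := by
    simp only [add_mul, mul_add, smul_mul_smul_comm, hab, mul_one, one_mul, he.eq,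
      he.mul_one_sub_self, he.one_sub_mul_self, he.one_sub.eq, zero_smul, add_zero, zero_add]
    rw [← add_smul, add_sub_cancel, one_smul]
  exact isUnit_iff_exists.mpr ⟨_, key W V hWV, key V W hVW⟩


/-- Let `s, t > 1` be coprime naturals and `n ≥ 2`. For any invertible `n×n` matrix `X`
over `ℤ/(st)ℤ` there exist a matrix `Y` and a scalar `k` such that `s • Y + k • I`
commutes with `X`, is invertible, and is not a scalar matrix. -/
theorem exists_nonscalar_unit_commuting_coprime_factors
    (s t n : ℕ) (hs : 1 < s) (ht : 1 < t) (hst : Nat.Coprime s t) (hn : 2 ≤ n)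
    (X : Matrix (Fin n) (Fin n) (ZMod (s * t))) (hX : IsUnit X) :
    ∃ (Y : Matrix (Fin n) (Fin n) (ZMod (s * t))) (k : ZMod (s * t)),
      ((s : ZMod (s * t)) • Y + k • 1) * X = X * ((s : ZMod (s * t)) • Y + k • 1) ∧
      IsUnit ((s : ZMod (s * t)) • Y + k • 1) ∧
      ¬ ∃ c : ZMod (s * t),
          (s : ZMod (s * t)) • Y + k • 1
            = c • (1 : Matrix (Fin n) (Fin n) (ZMod (s * t))) := by
  have : Nontrivial (Fin n) := Fin.nontrivial_iff_two_le.mpr hn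
  obtain ⟨a, b, hab⟩ := Nat.isCoprime_iff_coprime.mpr hst
  replace hab : (a : ZMod (s * t)) * s + b * t = 1 := by
    simpa using congrArg (Int.cast : ℤ → ZMod (s * t)) hab
  have hst0 : (s : ZMod (s * t)) * t = 0 := by exact_mod_cast ZMod.natCast_self (s * t)
  have hs0 : (s : ZMod (s * t)) ≠ 0 := by
    rw [Ne, ZMod.natCast_eq_zero_iff]
    exact fun h ↦ absurd (Nat.le_of_dvd (by omega) h) (by nlinarith)
  set e : ZMod (s * t) := s * a with he_def
  have he : e ≠ 0 := fun h ↦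
    hs0 (by linear_combination (-s : ZMod (s * t)) * hab + s * h + b * hst0)
  have hidem : IsIdempotentElem e := by
    rw [IsIdempotentElem]
    linear_combination e * hab - a * b * hst0
  obtain ⟨W, hW, hWX, hWs⟩ := Matrix.exists_isUnit_commute_smul_not_scalar he hX
  have hZ : (s : ZMod (s * t)) • ((a : ZMod (s * t)) • (W - 1)) + (1 : ZMod (s * t)) • 1
      = e • W + (1 - e) • 1 := by
    rw [smul_smul, ← he_def]
    module
  refine ⟨(a : ZMod (s * t)) • (W - 1), 1, ?_⟩
  rw [hZ]
  refine ⟨hWX.add_left ((Commute.one_left X).smul_left _), hW.smul_add_one_sub_smul_one hidem, ?_⟩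
  rintro ⟨c, hc⟩
  exact hWs ⟨c - (1 - e), by rw [sub_smul, ← hc, add_sub_cancel_right]⟩
end
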